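/- arXiv:1903.05851 — 3 statements merged into one kernel-verified Lean document; each statement's English description precedes it below -/
import Mathlib

section
/- Let N, S, Θ1, Θ2 : Ω → ℝ be random variables on a probability space (Ω, 𝓕, P), let λ1, λ2 > 0 and ψ1 ≥ 0, let V1 : ℝ → ℝ be measurable, write G = σ(Θ1, Θ2) and H = σ(N, Θ1, Θ2). Assume N and S are square-integrable, that N²·Θ2, V1(λ1·Θ1)·Θ2, Θ1²·Θ2, and Θ1·Θ2 are integrable, that E[S | H] = N·λ2·Θ2 almost surely, that E[N | G] = λ1·Θ1 and E[N² | G] = V1(λ1·Θ1)·ψ1 + (λ1·Θ1)² almost surely, and that E[Θ1] = 1. Then Cov(N, S) = λ2·ψ1·E[V1(λ1·Θ1)·Θ2] + λ1²·λ2·E[Θ1²·Θ2] − λ1²·λ2·E[Θ1·Θ2]. -/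
open MeasureTheory ProbabilityTheory

theorem aux_pull {Ω : Type*} {m m0 : MeasurableSpace Ω} (hm : m ≤ m0) (P : Measure Ω)
    [IsProbabilityMeasure P] (f g h : Ω → ℝ) (hf : Measurable[m] f)
    (hfg : Integrable (fun ω => f ω * g ω) P) (hg : Integrable g P)
    (hh : P[g | m] =ᵐ[P] h) :
    ∫ ω, f ω * g ω ∂P = ∫ ω, f ω * h ω ∂P := by
  have h1 : P[f * g | m] =ᵐ[P] f * P[g | m] :=
    condExp_mul_of_stronglyMeasurable_left hf.stronglyMeasurable hfg hg
  have h2 : ∫ ω, (P[f * g | m]) ω ∂P = ∫ ω, (f * g) ω ∂P := integral_condExp hm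
  have h3 : ∫ ω, (P[f * g | m]) ω ∂P = ∫ ω, f ω * h ω ∂P := by
    apply integral_congr_ae
    filter_upwards [h1, hh] with ω a b
    rw [a, Pi.mul_apply, b]
  rw [← h3, h2]
  rfl

theorem stmt_4 {Ω : Type*} [MeasurableSpace Ω] (P : Measure Ω) [IsProbabilityMeasure P]
    (N S Θ1 Θ2 : Ω → ℝ) (hN : Measurable N) (hSmeas : Measurable S)
    (hΘ1 : Measurable Θ1) (hΘ2 : Measurable Θ2)
    (l1 l2 : ℝ) (hl1 : 0 < l1) (hl2 : 0 < l2)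
    (ψ1 : ℝ) (hψ1 : 0 ≤ ψ1)
    (V1 : ℝ → ℝ) (hV1 : Measurable V1)
    (hNsq : MemLp N 2 P) (hSsq : MemLp S 2 P)
    (hint1 : Integrable (fun ω => N ω ^ 2 * Θ2 ω) P)
    (hint2 : Integrable (fun ω => V1 (l1 * Θ1 ω) * Θ2 ω) P)
    (hint3 : Integrable (fun ω => Θ1 ω ^ 2 * Θ2 ω) P)
    (hint4 : Integrable (fun ω => Θ1 ω * Θ2 ω) P)
    (hSH : P[S | MeasurableSpace.comap N inferInstance ⊔ MeasurableSpace.comap Θ1 inferInstance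
        ⊔ MeasurableSpace.comap Θ2 inferInstance] =ᵐ[P] fun ω => N ω * (l2 * Θ2 ω))
    (hNG : P[N | MeasurableSpace.comap Θ1 inferInstance ⊔ MeasurableSpace.comap Θ2 inferInstance]
        =ᵐ[P] fun ω => l1 * Θ1 ω)
    (hN2G : P[(fun ω => N ω ^ 2) | MeasurableSpace.comap Θ1 inferInstance
        ⊔ MeasurableSpace.comap Θ2 inferInstance]
        =ᵐ[P] fun ω => V1 (l1 * Θ1 ω) * ψ1 + (l1 * Θ1 ω) ^ 2)
    (hEΘ1 : ∫ ω, Θ1 ω ∂P = 1) :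
    (∫ ω, N ω * S ω ∂P) - (∫ ω, N ω ∂P) * (∫ ω, S ω ∂P)
      = l2 * ψ1 * (∫ ω, V1 (l1 * Θ1 ω) * Θ2 ω ∂P)
        + l1 ^ 2 * l2 * (∫ ω, Θ1 ω ^ 2 * Θ2 ω ∂P)
        - l1 ^ 2 * l2 * (∫ ω, Θ1 ω * Θ2 ω ∂P) := by
  have hGle : MeasurableSpace.comap Θ1 inferInstance ⊔ MeasurableSpace.comap Θ2 inferInstance
      ≤ (inferInstance : MeasurableSpace Ω) := sup_le hΘ1.comap_le hΘ2.comap_le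
  have hHle : MeasurableSpace.comap N inferInstance ⊔ MeasurableSpace.comap Θ1 inferInstance
        ⊔ MeasurableSpace.comap Θ2 inferInstance ≤ (inferInstance : MeasurableSpace Ω) :=
    sup_le (sup_le hN.comap_le hΘ1.comap_le) hΘ2.comap_le
  have hNH : Measurable[MeasurableSpace.comap N inferInstance
      ⊔ MeasurableSpace.comap Θ1 inferInstance ⊔ MeasurableSpace.comap Θ2 inferInstance] N :=
    (comap_measurable N).mono (le_sup_left.trans le_sup_left) le_rfl
  have hΘG : Measurable[MeasurableSpace.comap Θ1 inferInstance
      ⊔ MeasurableSpace.comap Θ2 inferInstance] Θ2 :=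
    (comap_measurable Θ2).mono le_sup_right le_rfl
  have iN : Integrable N P := hNsq.integrable (by norm_num)
  have iS : Integrable S P := hSsq.integrable (by norm_num)
  have iN2 : Integrable (fun ω => N ω ^ 2) P := hNsq.integrable_sq
  have iNS : Integrable (fun ω => N ω * S ω) P := hNsq.integrable_mul hSsq
  have iNT' : Integrable (fun ω => N ω * (l2 * Θ2 ω)) P := integrable_condExp.congr hSH
  have iNT : Integrable (fun ω => Θ2 ω * N ω) P := by
    refine (iNT'.const_mul l2⁻¹).congr (ae_of_all _ fun ω => ?_)
    simp only
    field_simp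
  have e1 := aux_pull hHle P N S _ hNH iNS iS hSH
  have e2 := aux_pull hGle P Θ2 N _ hΘG iNT iN hNG
  have e3 := aux_pull hGle P Θ2 (fun ω => N ω ^ 2) _ hΘG
    (hint1.congr (ae_of_all _ fun ω => mul_comm _ _)) iN2 hN2G
  have e4 : ∫ ω, S ω ∂P = ∫ ω, N ω * (l2 * Θ2 ω) ∂P := by
    rw [← integral_condExp hHle]
    exact integral_congr_ae hSH
  have e5 : ∫ ω, N ω ∂P = l1 := by
    rw [← integral_condExp hGle, integral_congr_ae hNG, integral_const_mul, hEΘ1, mul_one]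
  have e6 : ∫ ω, N ω * (l2 * Θ2 ω) ∂P = l2 * ∫ ω, Θ2 ω * N ω ∂P := by
    rw [← integral_const_mul]
    congr 1; ext ω; ring
  have e7 : ∫ ω, Θ2 ω * (l1 * Θ1 ω) ∂P = l1 * ∫ ω, Θ1 ω * Θ2 ω ∂P := by
    rw [← integral_const_mul]
    congr 1; ext ω; ring
  have e8 : ∫ ω, N ω * (N ω * (l2 * Θ2 ω)) ∂P = l2 * ∫ ω, Θ2 ω * N ω ^ 2 ∂P := by
    rw [← integral_const_mul]
    congr 1; ext ω; ring
  have e9 : ∫ ω, Θ2 ω * (V1 (l1 * Θ1 ω) * ψ1 + (l1 * Θ1 ω) ^ 2) ∂P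
      = ψ1 * (∫ ω, V1 (l1 * Θ1 ω) * Θ2 ω ∂P) + l1 ^ 2 * ∫ ω, Θ1 ω ^ 2 * Θ2 ω ∂P := by
    rw [← integral_const_mul, ← integral_const_mul,
      ← integral_add (hint2.const_mul _) (hint3.const_mul _)]
    congr 1; ext ω; ring
  rw [e1, e8, e3, e9, e4, e5, e6, e2, e7]
  ring
end

section
/- On a probability space (Ω, 𝓕, P), let U and V be independent standard normal random variables, let σ1, σ2 > 0 and ρ ∈ [−1, 1], and define Θ1 = exp(−σ1²/2 + σ1·U) and Θ2 = exp(−σ2²/2 + σ2·(ρ·U + √(1 − ρ²)·V)). Let Y1, Y2 : Ω → ℝ be square-integrable, let λ2 > 0 and ψ2 > 0, and assume E[Y1·Y2 | σ(Θ2)] = E[Y1 | σ(Θ2)]·E[Y2 | σ(Θ2)] almost surely and, for i = 1, 2, E[Yi | σ(Θ2)] = λ2·Θ2 and E[Yi² | σ(Θ2)] = (λ2·Θ2)²·ψ2 + (λ2·Θ2)² almost surely. Then Cov(Y1, Y2)/√(Var(Y1)·Var(Y2)) = (exp(σ2²) − 1)/((1 + ψ2)·exp(σ2²) − 1). -/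
open MeasureTheory ProbabilityTheory

lemma aux_moment {Ω : Type*} [MeasurableSpace Ω] (P : Measure Ω) [IsProbabilityMeasure P]
    (U V : Ω → ℝ) (hU : Measurable U) (hV : Measurable V)
    (hUV : IndepFun U V P)
    (hUlaw : P.map U = gaussianReal 0 1) (hVlaw : P.map V = gaussianReal 0 1)
    (c a b : ℝ) :
    ∫ ω, Real.exp (c + (a * U ω + b * V ω)) ∂P = Real.exp (c + (a ^ 2 + b ^ 2) / 2) := by
  have hu : ∫ ω, Real.exp (a * U ω) ∂P = Real.exp (a ^ 2 / 2) := by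
    have := mgf_gaussianReal hUlaw a
    simpa [mgf] using this
  have hv : ∫ ω, Real.exp (b * V ω) ∂P = Real.exp (b ^ 2 / 2) := by
    have := mgf_gaussianReal hVlaw b
    simpa [mgf] using this
  have hi : IndepFun (fun ω => Real.exp (a * U ω)) (fun ω => Real.exp (b * V ω)) P :=
    hUV.comp (φ := fun x => Real.exp (a * x)) (ψ := fun x => Real.exp (b * x))
      (by fun_prop) (by fun_prop)
  have hm := hi.integral_fun_mul_eq_mul_integral
    (by fun_prop) (by fun_prop)
  simp only [Real.exp_add, add_div]
  rw [integral_const_mul, hm, hu, hv]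

theorem stmt_18 {Ω : Type*} [MeasurableSpace Ω] (P : Measure Ω) [IsProbabilityMeasure P]
    (U V : Ω → ℝ) (hU : Measurable U) (hV : Measurable V)
    (hUV : IndepFun U V P)
    (hUlaw : P.map U = gaussianReal 0 1) (hVlaw : P.map V = gaussianReal 0 1)
    (σ1 σ2 : ℝ) (hσ1 : 0 < σ1) (hσ2 : 0 < σ2)
    (ρ : ℝ) (hρ : ρ ∈ Set.Icc (-1 : ℝ) 1)
    (Θ1 Θ2 : Ω → ℝ)
    (hΘ1 : Θ1 = fun ω => Real.exp (-σ1 ^ 2 / 2 + σ1 * U ω))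
    (hΘ2 : Θ2 = fun ω =>
      Real.exp (-σ2 ^ 2 / 2 + σ2 * (ρ * U ω + Real.sqrt (1 - ρ ^ 2) * V ω)))
    (Y1 Y2 : Ω → ℝ) (hY1 : Measurable Y1) (hY2 : Measurable Y2)
    (hY1sq : MemLp Y1 2 P) (hY2sq : MemLp Y2 2 P)
    (l2 : ℝ) (hl2 : 0 < l2) (ψ2 : ℝ) (hψ2 : 0 < ψ2)
    (hmul : P[(fun ω => Y1 ω * Y2 ω) | MeasurableSpace.comap Θ2 inferInstance]
        =ᵐ[P] fun ω =>
          (P[Y1 | MeasurableSpace.comap Θ2 inferInstance]) ω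
          * (P[Y2 | MeasurableSpace.comap Θ2 inferInstance]) ω)
    (h1 : P[Y1 | MeasurableSpace.comap Θ2 inferInstance] =ᵐ[P] fun ω => l2 * Θ2 ω)
    (h2 : P[Y2 | MeasurableSpace.comap Θ2 inferInstance] =ᵐ[P] fun ω => l2 * Θ2 ω)
    (h1sq : P[(fun ω => Y1 ω ^ 2) | MeasurableSpace.comap Θ2 inferInstance]
        =ᵐ[P] fun ω => (l2 * Θ2 ω) ^ 2 * ψ2 + (l2 * Θ2 ω) ^ 2)
    (h2sq : P[(fun ω => Y2 ω ^ 2) | MeasurableSpace.comap Θ2 inferInstance]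
        =ᵐ[P] fun ω => (l2 * Θ2 ω) ^ 2 * ψ2 + (l2 * Θ2 ω) ^ 2) :
    ((∫ ω, Y1 ω * Y2 ω ∂P) - (∫ ω, Y1 ω ∂P) * (∫ ω, Y2 ω ∂P))
        / Real.sqrt (((∫ ω, Y1 ω ^ 2 ∂P) - (∫ ω, Y1 ω ∂P) ^ 2)
            * ((∫ ω, Y2 ω ^ 2 ∂P) - (∫ ω, Y2 ω ∂P) ^ 2))
      = (Real.exp (σ2 ^ 2) - 1) / ((1 + ψ2) * Real.exp (σ2 ^ 2) - 1) := by
  have hmeas : Measurable Θ2 := by rw [hΘ2]; fun_prop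
  have hle : MeasurableSpace.comap Θ2 inferInstance ≤ (inferInstance : MeasurableSpace Ω) :=
    hmeas.comap_le
  have hr : Real.sqrt (1 - ρ ^ 2) ^ 2 = 1 - ρ ^ 2 :=
    Real.sq_sqrt (by nlinarith [hρ.1, hρ.2])
  have e1 : ∫ ω, Θ2 ω ∂P = 1 := by
    have h := aux_moment P U V hU hV hUV hUlaw hVlaw (-σ2 ^ 2 / 2) (σ2 * ρ)
      (σ2 * Real.sqrt (1 - ρ ^ 2))
    rw [mul_pow, mul_pow, hr] at h
    rw [hΘ2]
    convert h using 1
    · congr 1; ext ω; congr 1; ring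
    · symm; rw [Real.exp_eq_one_iff]; ring
  have e2 : ∫ ω, Θ2 ω ^ 2 ∂P = Real.exp (σ2 ^ 2) := by
    have h := aux_moment P U V hU hV hUV hUlaw hVlaw (-σ2 ^ 2) (2 * σ2 * ρ)
      (2 * σ2 * Real.sqrt (1 - ρ ^ 2))
    rw [mul_pow, mul_pow _ (Real.sqrt _), hr] at h
    rw [hΘ2]
    convert h using 1
    · congr 1; ext ω; rw [← Real.exp_nat_mul]; congr 1; push_cast; ring
    · congr 1; ring
  have m1 : ∫ ω, Y1 ω ∂P = l2 := by
    rw [← integral_condExp hle, integral_congr_ae h1, integral_const_mul, e1, mul_one]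
  have m2 : ∫ ω, Y2 ω ∂P = l2 := by
    rw [← integral_condExp hle, integral_congr_ae h2, integral_const_mul, e1, mul_one]
  have hq : ∫ ω, ((l2 * Θ2 ω) ^ 2 * ψ2 + (l2 * Θ2 ω) ^ 2) ∂P
      = l2 ^ 2 * (1 + ψ2) * Real.exp (σ2 ^ 2) := by
    rw [← e2, ← integral_const_mul]
    congr 1; ext ω; ring
  have s1 : ∫ ω, Y1 ω ^ 2 ∂P = l2 ^ 2 * (1 + ψ2) * Real.exp (σ2 ^ 2) := by
    rw [← integral_condExp hle, integral_congr_ae h1sq, hq]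
  have s2 : ∫ ω, Y2 ω ^ 2 ∂P = l2 ^ 2 * (1 + ψ2) * Real.exp (σ2 ^ 2) := by
    rw [← integral_condExp hle, integral_congr_ae h2sq, hq]
  have c12 : ∫ ω, Y1 ω * Y2 ω ∂P = l2 ^ 2 * Real.exp (σ2 ^ 2) := by
    have h : P[(fun ω => Y1 ω * Y2 ω) | MeasurableSpace.comap Θ2 inferInstance]
        =ᵐ[P] fun ω => l2 ^ 2 * Θ2 ω ^ 2 := by
      filter_upwards [hmul, h1, h2] with ω a b c
      rw [a, b, c]; ring
    rw [← integral_condExp hle, integral_congr_ae h, integral_const_mul, e2]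
  have hE : 1 < Real.exp (σ2 ^ 2) := Real.one_lt_exp_iff.mpr (by positivity)
  have hD : 0 < (1 + ψ2) * Real.exp (σ2 ^ 2) - 1 := by nlinarith
  rw [m1, m2, s1, s2, c12]
  have hx : l2 ^ 2 * (1 + ψ2) * Real.exp (σ2 ^ 2) - l2 ^ 2
      = l2 ^ 2 * ((1 + ψ2) * Real.exp (σ2 ^ 2) - 1) := by ring
  rw [hx, Real.sqrt_mul_self (by positivity)]
  have hl : l2 ^ 2 ≠ 0 := by positivity
  rw [show l2 ^ 2 * Real.exp (σ2 ^ 2) - l2 * l2 = l2 ^ 2 * (Real.exp (σ2 ^ 2) - 1) by ring,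
    mul_div_mul_left _ _ hl]
end

section
/- On a probability space (Ω, 𝓕, P), let U and V be independent standard normal random variables, let σ1, σ2 > 0 and ρ ∈ [−1, 1], and define Θ1 = exp(−σ1²/2 + σ1·U) and Θ2 = exp(−σ2²/2 + σ2·(ρ·U + √(1 − ρ²)·V)). Let N, Y : Ω → ℝ be square-integrable, let λ1, λ2 > 0 and ψ2 > 0, write G = σ(Θ1, Θ2), and assume E[N·Y | G] = E[N | G]·E[Y | G] almost surely, E[N | G] = λ1·Θ1 and E[N² | G] = λ1·Θ1 + (λ1·Θ1)² almost surely, and E[Y | G] = λ2·Θ2 and E[Y² | G] = (λ2·Θ2)²·ψ2 + (λ2·Θ2)² almost surely. Then Cov(N, Y)/√(Var(N)·Var(Y)) = λ1·(exp(ρ·σ1·σ2) − 1) / (√(λ1·(1 + λ1·(exp(σ1²) − 1))) · √((1 + ψ2)·exp(σ2²) − 1)). -/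
open MeasureTheory ProbabilityTheory

lemma exp_aux {Ω : Type*} [MeasurableSpace Ω] (P : Measure Ω) [IsProbabilityMeasure P]
    (U V : Ω → ℝ) (hU : Measurable U) (hV : Measurable V)
    (hUV : IndepFun U V P)
    (hUlaw : P.map U = gaussianReal 0 1) (hVlaw : P.map V = gaussianReal 0 1) (c a b : ℝ) :
    Integrable (fun ω => Real.exp (c + a * U ω + b * V ω)) P ∧
    ∫ ω, Real.exp (c + a * U ω + b * V ω) ∂P = Real.exp (c + a ^ 2 / 2 + b ^ 2 / 2) := by
  have key : ∀ (W : Ω → ℝ), Measurable W → P.map W = gaussianReal 0 1 → ∀ t : ℝ,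
      Integrable (fun ω => Real.exp (t * W ω)) P ∧
      ∫ ω, Real.exp (t * W ω) ∂P = Real.exp (t ^ 2 / 2) := by
    intro W hW hl t
    constructor
    · have h := integrable_exp_mul_gaussianReal (μ := 0) (v := 1) t
      rw [← hl] at h
      exact h.comp_measurable hW
    · have h := mgf_gaussianReal hl t
      simpa [mgf] using h
  have hind : IndepFun (fun ω => Real.exp (a * U ω)) (fun ω => Real.exp (b * V ω)) P :=
    hUV.comp (φ := fun x => Real.exp (a * x)) (ψ := fun x => Real.exp (b * x))
      (by fun_prop) (by fun_prop)
  have e : (fun ω => Real.exp (c + a * U ω + b * V ω))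
      = fun ω => Real.exp c * (Real.exp (a * U ω) * Real.exp (b * V ω)) := by
    funext ω
    rw [Real.exp_add, Real.exp_add, mul_assoc]
  rw [e]
  constructor
  · exact (hind.integrable_mul (key U hU hUlaw a).1 (key V hV hVlaw b).1).const_mul _
  · rw [integral_const_mul, hind.integral_fun_mul_eq_mul_integral
      (key U hU hUlaw a).1.aestronglyMeasurable (key V hV hVlaw b).1.aestronglyMeasurable,
      (key U hU hUlaw a).2, (key V hV hVlaw b).2, Real.exp_add, Real.exp_add, mul_assoc]

theorem stmt_19 {Ω : Type*} [MeasurableSpace Ω] (P : Measure Ω) [IsProbabilityMeasure P]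
    (U V : Ω → ℝ) (hU : Measurable U) (hV : Measurable V)
    (hUV : IndepFun U V P)
    (hUlaw : P.map U = gaussianReal 0 1) (hVlaw : P.map V = gaussianReal 0 1)
    (σ1 σ2 : ℝ) (hσ1 : 0 < σ1) (hσ2 : 0 < σ2)
    (ρ : ℝ) (hρ : ρ ∈ Set.Icc (-1 : ℝ) 1)
    (Θ1 Θ2 : Ω → ℝ)
    (hΘ1 : Θ1 = fun ω => Real.exp (-σ1 ^ 2 / 2 + σ1 * U ω))
    (hΘ2 : Θ2 = fun ω =>
      Real.exp (-σ2 ^ 2 / 2 + σ2 * (ρ * U ω + Real.sqrt (1 - ρ ^ 2) * V ω)))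
    (N Y : Ω → ℝ) (hN : Measurable N) (hY : Measurable Y)
    (hNsq : MemLp N 2 P) (hYsq : MemLp Y 2 P)
    (l1 l2 : ℝ) (hl1 : 0 < l1) (hl2 : 0 < l2) (ψ2 : ℝ) (hψ2 : 0 < ψ2)
    (hmul : P[(fun ω => N ω * Y ω) | MeasurableSpace.comap Θ1 inferInstance
        ⊔ MeasurableSpace.comap Θ2 inferInstance]
        =ᵐ[P] fun ω =>
          (P[N | MeasurableSpace.comap Θ1 inferInstance
              ⊔ MeasurableSpace.comap Θ2 inferInstance]) ω
          * (P[Y | MeasurableSpace.comap Θ1 inferInstance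
              ⊔ MeasurableSpace.comap Θ2 inferInstance]) ω)
    (hNG : P[N | MeasurableSpace.comap Θ1 inferInstance ⊔ MeasurableSpace.comap Θ2 inferInstance]
        =ᵐ[P] fun ω => l1 * Θ1 ω)
    (hN2G : P[(fun ω => N ω ^ 2) | MeasurableSpace.comap Θ1 inferInstance
        ⊔ MeasurableSpace.comap Θ2 inferInstance]
        =ᵐ[P] fun ω => l1 * Θ1 ω + (l1 * Θ1 ω) ^ 2)
    (hYG : P[Y | MeasurableSpace.comap Θ1 inferInstance ⊔ MeasurableSpace.comap Θ2 inferInstance]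
        =ᵐ[P] fun ω => l2 * Θ2 ω)
    (hY2G : P[(fun ω => Y ω ^ 2) | MeasurableSpace.comap Θ1 inferInstance
        ⊔ MeasurableSpace.comap Θ2 inferInstance]
        =ᵐ[P] fun ω => (l2 * Θ2 ω) ^ 2 * ψ2 + (l2 * Θ2 ω) ^ 2) :
    ((∫ ω, N ω * Y ω ∂P) - (∫ ω, N ω ∂P) * (∫ ω, Y ω ∂P))
        / Real.sqrt (((∫ ω, N ω ^ 2 ∂P) - (∫ ω, N ω ∂P) ^ 2)
            * ((∫ ω, Y ω ^ 2 ∂P) - (∫ ω, Y ω ∂P) ^ 2))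
      = l1 * (Real.exp (ρ * σ1 * σ2) - 1)
        / (Real.sqrt (l1 * (1 + l1 * (Real.exp (σ1 ^ 2) - 1)))
            * Real.sqrt ((1 + ψ2) * Real.exp (σ2 ^ 2) - 1)) := by
  have hr : Real.sqrt (1 - ρ ^ 2) ^ 2 = 1 - ρ ^ 2 :=
    Real.sq_sqrt (by nlinarith [hρ.1, hρ.2])
  set r := Real.sqrt (1 - ρ ^ 2) with hrdef
  have key := exp_aux P U V hU hV hUV hUlaw hVlaw
  have m1 : Measurable Θ1 := by rw [hΘ1]; fun_prop
  have m2 : Measurable Θ2 := by rw [hΘ2]; fun_prop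
  have hm : MeasurableSpace.comap Θ1 inferInstance ⊔ MeasurableSpace.comap Θ2 inferInstance
      ≤ (inferInstance : MeasurableSpace Ω) := sup_le m1.comap_le m2.comap_le
  have t1 : Integrable Θ1 P ∧ ∫ ω, Θ1 ω ∂P = 1 := by
    have h := key (-σ1 ^ 2 / 2) σ1 0
    have e : Θ1 = fun ω => Real.exp (-σ1 ^ 2 / 2 + σ1 * U ω + 0 * V ω) := by
      rw [hΘ1]; funext ω; congr 1; ring
    rw [e]
    refine ⟨h.1, h.2.trans ?_⟩
    rw [← Real.exp_zero]; congr 1; ring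
  have t11 : Integrable (fun ω => Θ1 ω ^ 2) P ∧ ∫ ω, Θ1 ω ^ 2 ∂P = Real.exp (σ1 ^ 2) := by
    have h := key (-σ1 ^ 2) (2 * σ1) 0
    have e : (fun ω => Θ1 ω ^ 2)
        = fun ω => Real.exp (-σ1 ^ 2 + 2 * σ1 * U ω + 0 * V ω) := by
      rw [hΘ1]; funext ω; simp only []; rw [← Real.exp_nat_mul]; congr 1; push_cast; ring
    rw [e]
    refine ⟨h.1, h.2.trans ?_⟩
    congr 1; ring
  have t2 : Integrable Θ2 P ∧ ∫ ω, Θ2 ω ∂P = 1 := by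
    have h := key (-σ2 ^ 2 / 2) (σ2 * ρ) (σ2 * r)
    have e : Θ2 = fun ω => Real.exp (-σ2 ^ 2 / 2 + σ2 * ρ * U ω + σ2 * r * V ω) := by
      rw [hΘ2]; funext ω; congr 1; ring
    rw [e]
    refine ⟨h.1, h.2.trans ?_⟩
    rw [← Real.exp_zero]; congr 1; rw [mul_pow, mul_pow, hr]; ring
  have t22 : Integrable (fun ω => Θ2 ω ^ 2) P ∧ ∫ ω, Θ2 ω ^ 2 ∂P = Real.exp (σ2 ^ 2) := by
    have h := key (-σ2 ^ 2) (2 * σ2 * ρ) (2 * σ2 * r)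
    have e : (fun ω => Θ2 ω ^ 2)
        = fun ω => Real.exp (-σ2 ^ 2 + 2 * σ2 * ρ * U ω + 2 * σ2 * r * V ω) := by
      rw [hΘ2]; funext ω; simp only []; rw [← Real.exp_nat_mul]; congr 1; push_cast; ring
    rw [e]
    refine ⟨h.1, h.2.trans ?_⟩
    congr 1; rw [mul_pow _ ρ, mul_pow _ r, hr]; ring
  have t12 : ∫ ω, Θ1 ω * Θ2 ω ∂P = Real.exp (ρ * σ1 * σ2) := by
    have h := key (-σ1 ^ 2 / 2 - σ2 ^ 2 / 2) (σ1 + σ2 * ρ) (σ2 * r)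
    have e : (fun ω => Θ1 ω * Θ2 ω) = fun ω =>
        Real.exp (-σ1 ^ 2 / 2 - σ2 ^ 2 / 2 + (σ1 + σ2 * ρ) * U ω + σ2 * r * V ω) := by
      rw [hΘ1, hΘ2]; funext ω; simp only []; rw [← Real.exp_add]; congr 1; ring
    rw [e]
    refine h.2.trans ?_
    congr 1; rw [mul_pow _ r, hr]; ring
  have EN : ∫ ω, N ω ∂P = l1 := by
    rw [← integral_condExp hm, integral_congr_ae hNG, integral_const_mul, t1.2, mul_one]
  have EY : ∫ ω, Y ω ∂P = l2 := by
    rw [← integral_condExp hm, integral_congr_ae hYG, integral_const_mul, t2.2, mul_one]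
  have EN2 : ∫ ω, N ω ^ 2 ∂P = l1 + l1 ^ 2 * Real.exp (σ1 ^ 2) := by
    rw [← integral_condExp hm, integral_congr_ae hN2G]
    simp only [mul_pow]
    rw [integral_add (t1.1.const_mul _) (t11.1.const_mul _), integral_const_mul,
      integral_const_mul, t1.2, t11.2, mul_one]
  have EY2 : ∫ ω, Y ω ^ 2 ∂P = l2 ^ 2 * ((1 + ψ2) * Real.exp (σ2 ^ 2)) := by
    rw [← integral_condExp hm, integral_congr_ae hY2G]
    have e : (fun ω => (l2 * Θ2 ω) ^ 2 * ψ2 + (l2 * Θ2 ω) ^ 2)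
        = fun ω => (l2 ^ 2 * (1 + ψ2)) * Θ2 ω ^ 2 := by
      funext ω; ring
    rw [e, integral_const_mul, t22.2, mul_assoc]
  have ENY : ∫ ω, N ω * Y ω ∂P = l1 * l2 * Real.exp (ρ * σ1 * σ2) := by
    have h2 : (fun ω =>
          (P[N | MeasurableSpace.comap Θ1 inferInstance
              ⊔ MeasurableSpace.comap Θ2 inferInstance]) ω
          * (P[Y | MeasurableSpace.comap Θ1 inferInstance
              ⊔ MeasurableSpace.comap Θ2 inferInstance]) ω)
        =ᵐ[P] fun ω => (l1 * l2) * (Θ1 ω * Θ2 ω) := by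
      filter_upwards [hNG, hYG] with ω h1 h2
      rw [h1, h2]; ring
    rw [← integral_condExp hm, integral_congr_ae (hmul.trans h2), integral_const_mul, t12]
  rw [EN, EY, EN2, EY2, ENY]
  have x1 : 1 ≤ Real.exp (σ1 ^ 2) := Real.one_le_exp (sq_nonneg _)
  have v1 : 0 ≤ l1 * (1 + l1 * (Real.exp (σ1 ^ 2) - 1)) := by
    have : 0 ≤ Real.exp (σ1 ^ 2) - 1 := by linarith
    positivity
  have e1 : (l1 + l1 ^ 2 * Real.exp (σ1 ^ 2) - l1 ^ 2)
        * (l2 ^ 2 * ((1 + ψ2) * Real.exp (σ2 ^ 2)) - l2 ^ 2)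
      = (l1 * (1 + l1 * (Real.exp (σ1 ^ 2) - 1))) *
        (l2 ^ 2 * ((1 + ψ2) * Real.exp (σ2 ^ 2) - 1)) := by ring
  rw [e1, Real.sqrt_mul v1, Real.sqrt_mul (sq_nonneg l2), Real.sqrt_sq hl2.le]
  have e2 : l1 * l2 * Real.exp (ρ * σ1 * σ2) - l1 * l2
      = l2 * (l1 * (Real.exp (ρ * σ1 * σ2) - 1)) := by ring
  rw [e2, mul_left_comm (Real.sqrt _) l2, mul_div_mul_left _ _ hl2.ne']
end
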